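/- Let I be a finite index set, let w : I → ℝ be prior-step particle weights with w j > 0 for all j ∈ I and ∑_{j ∈ I} w j = 1, let w' : I → ℝ be posterior-step particle weights with w' i ≥ 0 for all i ∈ I, let p : I → ℝ satisfy 0 < p i ≤ n for all i ∈ I, let q : I × I → ℝ satisfy q i j > 0 for all i, j ∈ I, and let A, A' ⊆ I be nonempty subsets. Define Ĥ ≜ log(∑_{i ∈ I} p i · w i) − ∑_{i ∈ I} w' i · log(p i · ∑_{j ∈ I} q i j · w j) (the Boers et al. entropy estimator). Then Ĥ ≤ log(∑_{i ∈ A} p i · w i + n · (1 − ∑_{i ∈ A} w i)) − ∑_{i ∈ I} w' i · log(∑_{j ∈ A'} p i · q i j · w j). (Combined simplification upper bound Ĥ(b_{k+1}) ≤ ub(b^s_k, b^s_{k+1}, b_k, b_{k+1}), obtained by combining the upper bounds of Theorems 2 and 3.) -/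

import Mathlib

/-- Combined simplification upper bound on the Boers et al. entropy estimator,
obtained by combining the upper bounds of Theorems 2 and 3. -/
theorem stmt_5 {I : Type*} [Fintype I]
    (w w' p : I → ℝ) (q : I → I → ℝ) (n : ℝ)
    (hw : ∀ j, 0 < w j) (hwsum : ∑ j, w j = 1)
    (hw' : ∀ i, 0 ≤ w' i)
    (hp : ∀ i, 0 < p i) (hpn : ∀ i, p i ≤ n)
    (hq : ∀ i j, 0 < q i j)
    (A A' : Finset I) (hA : A.Nonempty) (hA' : A'.Nonempty) :
    Real.log (∑ i, p i * w i)
        - ∑ i, w' i * Real.log (p i * ∑ j, q i j * w j) ≤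
      Real.log ((∑ i ∈ A, p i * w i) + n * (1 - ∑ i ∈ A, w i))
        - ∑ i, w' i * Real.log (∑ j ∈ A', p i * q i j * w j) := by
  obtain ⟨a, ha⟩ := hA
  obtain ⟨a', ha'⟩ := hA'
  have hpos : 0 < ∑ i, p i * w i :=
    Finset.sum_pos (fun i _ => mul_pos (hp i) (hw i)) ⟨a, Finset.mem_univ a⟩
  have hgap : ∑ i ∈ A, (n - p i) * w i ≤ ∑ i, (n - p i) * w i :=
    Finset.sum_le_sum_of_subset_of_nonneg (Finset.subset_univ A) fun i _ _ =>
      mul_nonneg (sub_nonneg.2 (hpn i)) (hw i).le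
  simp only [sub_mul, Finset.sum_sub_distrib, ← Finset.mul_sum, hwsum] at hgap
  refine sub_le_sub (Real.log_le_log hpos (by linarith)) (Finset.sum_le_sum fun i _ => ?_)
  have hterm (j : I) : 0 < p i * q i j * w j := mul_pos (mul_pos (hp i) (hq i j)) (hw j)
  refine mul_le_mul_of_nonneg_left (Real.log_le_log ?_ ?_) (hw' i)
  · exact Finset.sum_pos (fun j _ => hterm j) ⟨a', ha'⟩
  · simp only [Finset.mul_sum, ← mul_assoc]
    exact Finset.sum_le_sum_of_subset_of_nonneg (Finset.subset_univ A') fun j _ _ => (hterm j).le
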